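/- Let ℓ be an integral domain. If β : Ω₀ → Ω₁, β(p) = (p, 0), is a polynomial homotopy equivalence, then the ℓ-algebra Ω₀ is polynomially contractible, i.e. the identity of Ω₀ is polynomially homotopic to the zero endomorphism. -/

import Mathlib

open Polynomial

variable (ℓ : Type) [CommRing ℓ]

section PolyNU
variable (B : Type) [NonUnitalRing B] [Module ℓ B] [IsScalarTower ℓ B B] [SMulCommClass ℓ B B]

/-- The algebra `B[t]` of polynomials with coefficients in the non-unital algebra `B`,
realized as the non-unital subalgebra of `(Unitization ℓ B)[X]` consisting of the polynomials
all of whose coefficients lie in `B` (i.e. have vanishing scalar part). -/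
def polyNU : NonUnitalSubalgebra ℓ (Polynomial (Unitization ℓ B)) where
  carrier := {p | ∀ n, (p.coeff n).fst = 0}
  add_mem' := by
    intro p q hp hq n
    simp [hp n, hq n]
  zero_mem' := by intro n; simp
  mul_mem' := by
    intro p q hp hq n
    rw [Polynomial.coeff_mul]
    rw [← Unitization.fstHom_apply ℓ B, map_sum]
    refine Finset.sum_eq_zero fun x _ => ?_
    simp [hp x.1]
  smul_mem' := by
    intro c p hp n
    simp [Polynomial.coeff_smul, hp n]

end PolyNU

section EvAt
variable {ℓ} {B : Type} [NonUnitalRing B] [Module ℓ B] [IsScalarTower ℓ B B] [SMulCommClass ℓ B B]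

theorem fst_eval_polyNU (r : ℓ) (p : polyNU ℓ B) :
    (Polynomial.eval (algebraMap ℓ (Unitization ℓ B) r) (p : Polynomial (Unitization ℓ B))).fst
      = 0 := by
  have h : ((p : Polynomial (Unitization ℓ B)).map
      (Unitization.fstHom ℓ B).toRingHom) = 0 := by
    ext n
    simpa using p.2 n
  have h2 : (Unitization.fstHom ℓ B).toRingHom
      (((p : Polynomial (Unitization ℓ B))).eval₂ (RingHom.id _)
        (algebraMap ℓ (Unitization ℓ B) r))
      = ((p : Polynomial (Unitization ℓ B))).eval₂
          ((Unitization.fstHom ℓ B).toRingHom.comp (RingHom.id _))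
          ((Unitization.fstHom ℓ B).toRingHom (algebraMap ℓ (Unitization ℓ B) r)) :=
    Polynomial.hom_eval₂ _ _ _ _
  rw [Polynomial.eval₂_eq_eval_map, Polynomial.eval₂_eq_eval_map, Polynomial.map_id,
    RingHom.comp_id, h] at h2
  simpa using h2

/-- Evaluation of a polynomial with coefficients in `B` at the scalar `r : ℓ`. -/
noncomputable def evAt (r : ℓ) : polyNU ℓ B →ₙₐ[ℓ] B where
  toFun p := (Polynomial.eval (algebraMap ℓ (Unitization ℓ B) r)
      (p : Polynomial (Unitization ℓ B))).snd
  map_add' p q := by simp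
  map_smul' c p := by simp [Polynomial.eval_smul]
  map_zero' := by simp
  map_mul' p q := by
    have hc : ∀ k : Unitization ℓ B, Commute k (algebraMap ℓ (Unitization ℓ B) r) :=
      fun k => (Algebra.commutes r k).symm
    have : Polynomial.eval (algebraMap ℓ (Unitization ℓ B) r)
        ((p : Polynomial (Unitization ℓ B)) * (q : Polynomial (Unitization ℓ B)))
        = Polynomial.eval (algebraMap ℓ (Unitization ℓ B) r) (p : Polynomial (Unitization ℓ B))
          * Polynomial.eval (algebraMap ℓ (Unitization ℓ B) r)
            (q : Polynomial (Unitization ℓ B)) :=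
      Polynomial.eval₂_mul_noncomm (RingHom.id _) _
        (fun k => (Algebra.commutes r _).symm)
    simp only [NonUnitalSubalgebra.coe_mul, this, Unitization.snd_mul,
      fst_eval_polyNU, zero_smul, zero_add]

end EvAt

section Homotopy
variable {ℓ}
variable {A B : Type} [NonUnitalRing A] [Module ℓ A] [IsScalarTower ℓ A A] [SMulCommClass ℓ A A]
  [NonUnitalRing B] [Module ℓ B] [IsScalarTower ℓ B B] [SMulCommClass ℓ B B]

/-- Two homomorphisms of non-unital `ℓ`-algebras are *elementarily (polynomially) homotopic*
if there is a homomorphism `H : A → B[t]` with `ev₀ ∘ H = f` and `ev₁ ∘ H = g`. -/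
def ElemHomotopic (f g : A →ₙₐ[ℓ] B) : Prop :=
  ∃ H : A →ₙₐ[ℓ] polyNU ℓ B, (evAt 0).comp H = f ∧ (evAt 1).comp H = g

/-- *Polynomial homotopy*: the equivalence relation generated by elementary homotopy. -/
def Homotopic (f g : A →ₙₐ[ℓ] B) : Prop :=
  Relation.EqvGen ElemHomotopic f g

end Homotopy

/-- A homomorphism of non-unital `ℓ`-algebras is a *polynomial homotopy equivalence* if it is
invertible up to polynomial homotopy. -/
def IsPHE {A B : Type}
    [NonUnitalRing A] [Module ℓ A] [IsScalarTower ℓ A A] [SMulCommClass ℓ A A]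
    [NonUnitalRing B] [Module ℓ B] [IsScalarTower ℓ B B] [SMulCommClass ℓ B B]
    (f : A →ₙₐ[ℓ] B) : Prop :=
  ∃ g : B →ₙₐ[ℓ] A, Homotopic (g.comp f) (NonUnitalAlgHom.id ℓ A) ∧
    Homotopic (f.comp g) (NonUnitalAlgHom.id ℓ B)



/-- The non-unital `ℓ`-algebra `Ω₀ := (t²−t)·ℓ[t] ⊆ ℓ[t]`. -/
def Omega0 : NonUnitalSubalgebra ℓ (Polynomial ℓ) where
  carrier := {p | ∃ q : Polynomial ℓ, p = (X ^ 2 - X) * q}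
  add_mem' := by
    rintro p p' ⟨q, rfl⟩ ⟨q', rfl⟩
    exact ⟨q + q', by ring⟩
  zero_mem' := ⟨0, by ring⟩
  mul_mem' := by
    rintro p p' ⟨q, rfl⟩ ⟨q', rfl⟩
    exact ⟨q * (X ^ 2 - X) * q', by ring⟩
  smul_mem' := by
    rintro c p ⟨q, rfl⟩
    exact ⟨c • q, by rw [mul_smul_comm]⟩

variable {ℓ} in
theorem Omega0.eval_eq_zero {p : Polynomial ℓ} (hp : p ∈ Omega0 ℓ) :
    p.eval 0 = 0 ∧ p.eval 1 = 0 := by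
  obtain ⟨q, rfl⟩ := hp
  constructor <;> simp

/-- The non-unital `ℓ`-algebra
`Ω₁ := {(p,q) ∈ ℓ[t] × ℓ[t] : p(1) = q(0), p(0) = q(1) = 0}`. -/
def Omega1 : NonUnitalSubalgebra ℓ (Polynomial ℓ × Polynomial ℓ) where
  carrier := {x | x.1.eval 1 = x.2.eval 0 ∧ x.1.eval 0 = 0 ∧ x.2.eval 1 = 0}
  add_mem' := by
    rintro x y ⟨h1, h2, h3⟩ ⟨h1', h2', h3'⟩
    refine ⟨?_, ?_, ?_⟩ <;> simp_all
  zero_mem' := by simp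
  mul_mem' := by
    rintro x y ⟨h1, h2, h3⟩ ⟨h1', h2', h3'⟩
    refine ⟨?_, ?_, ?_⟩ <;> simp_all
  smul_mem' := by
    rintro c x ⟨h1, h2, h3⟩
    refine ⟨?_, ?_, ?_⟩ <;> simp_all

/-- The homomorphism `β : Ω₀ → Ω₁`, `β(p) = (p, 0)`. -/
noncomputable def betaMap : Omega0 ℓ →ₙₐ[ℓ] Omega1 ℓ where
  toFun p := ⟨((p : Polynomial ℓ), 0),
    by
      obtain ⟨h0, h1⟩ := Omega0.eval_eq_zero p.2
      exact ⟨by simp [h1], by simp [h0], by simp⟩⟩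
  map_add' p q := by ext : 1 <;> simp
  map_mul' p q := by ext : 1 <;> simp
  map_zero' := by ext : 1 <;> simp
  map_smul' c p := by ext : 1 <;> simp

/-- The homomorphism `β̃ : Ω₀ → Ω₁`, `β̃(p) = (0, p)`. -/
noncomputable def betaTildeMap : Omega0 ℓ →ₙₐ[ℓ] Omega1 ℓ where
  toFun p := ⟨((0 : Polynomial ℓ), (p : Polynomial ℓ)),
    by
      obtain ⟨h0, h1⟩ := Omega0.eval_eq_zero p.2
      exact ⟨by simp [h0], by simp, by simp [h1]⟩⟩
  map_add' p q := by ext : 1 <;> simp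
  map_mul' p q := by ext : 1 <;> simp
  map_zero' := by ext : 1 <;> simp
  map_smul' c p := by ext : 1 <;> simp

section HomotopyComp
variable {ℓ}
variable {A B C : Type} [NonUnitalRing A] [Module ℓ A] [NonUnitalRing B] [Module ℓ B]
  [NonUnitalRing C] [Module ℓ C] [IsScalarTower ℓ C C] [SMulCommClass ℓ C C]

theorem Homotopic.comp_right {f g : B →ₙₐ[ℓ] C} (h : Homotopic f g) (k : A →ₙₐ[ℓ] B) :
    Homotopic (f.comp k) (g.comp k) := by
  induction h with
  | rel f g h =>
    obtain ⟨H, rfl, rfl⟩ := h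
    exact .rel _ _ ⟨H.comp k, rfl, rfl⟩
  | refl f => exact .refl _
  | symm f g _ ih => exact .symm _ _ ih
  | trans f g k _ _ ih ih' => exact .trans _ _ _ ih ih'

variable [IsScalarTower ℓ B B] [SMulCommClass ℓ B B]

/-- The homomorphism `Unitization ℓ B → Unitization ℓ C` induced by `f : B → C`. -/
noncomputable def unitizationMap (f : B →ₙₐ[ℓ] C) : Unitization ℓ B →ₐ[ℓ] Unitization ℓ C :=
  Unitization.lift ((Unitization.inrNonUnitalAlgHom ℓ C).comp f)

@[simp]
theorem fst_unitizationMap (f : B →ₙₐ[ℓ] C) (x : Unitization ℓ B) :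
    (unitizationMap f x).fst = x.fst := by
  simp [unitizationMap, Unitization.algebraMap_eq_inl]

@[simp]
theorem snd_unitizationMap (f : B →ₙₐ[ℓ] C) (x : Unitization ℓ B) :
    (unitizationMap f x).snd = f x.snd := by
  simp [unitizationMap, Unitization.algebraMap_eq_inl]

/-- The homomorphism `B[t] → C[t]` applying `f : B → C` to the coefficients. -/
noncomputable def polyNUMap (f : B →ₙₐ[ℓ] C) : polyNU ℓ B →ₙₐ[ℓ] polyNU ℓ C where
  toFun p := ⟨Polynomial.mapAlgHom (unitizationMap f) p, fun n => by
    simpa using p.2 n⟩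
  map_add' p q := by ext : 1; simp
  map_mul' p q := by ext : 1; simp
  map_zero' := by ext : 1; simp
  map_smul' c p := by
    ext : 1
    exact map_smul (Polynomial.mapAlgHom (unitizationMap f)) c (p : Polynomial (Unitization ℓ B))

theorem evAt_comp_polyNUMap (r : ℓ) (f : B →ₙₐ[ℓ] C) :
    (evAt r).comp (polyNUMap f) = f.comp (evAt r) := by
  ext p
  have h := Polynomial.eval_map_apply (f := (unitizationMap f).toRingHom)
    (p := (p : Polynomial (Unitization ℓ B))) (algebraMap ℓ (Unitization ℓ B) r)
  have h' : (unitizationMap f).toRingHom (algebraMap ℓ (Unitization ℓ B) r)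
      = algebraMap ℓ (Unitization ℓ C) r := (unitizationMap f).commutes r
  rw [h'] at h
  exact (congrArg (fun x => x.snd) h).trans (snd_unitizationMap f _)

theorem Homotopic.comp_left (k : B →ₙₐ[ℓ] C) {f g : A →ₙₐ[ℓ] B} (h : Homotopic f g) :
    Homotopic (k.comp f) (k.comp g) := by
  induction h with
  | rel f g h =>
    obtain ⟨H, rfl, rfl⟩ := h
    refine .rel _ _ ⟨(polyNUMap k).comp H, ?_, ?_⟩
    · exact congrArg (fun φ => NonUnitalAlgHom.comp φ H) (evAt_comp_polyNUMap 0 k)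
    · exact congrArg (fun φ => NonUnitalAlgHom.comp φ H) (evAt_comp_polyNUMap 1 k)
  | refl f => exact .refl _
  | symm f g _ ih => exact .symm _ _ ih
  | trans f g k _ _ ih ih' => exact .trans _ _ _ ih ih'

end HomotopyComp

/-- The involution of `Ω₀` reversing the parameter, `p(t) ↦ p(1 - t)`. -/
noncomputable def Omega0.reverse : Omega0 ℓ →ₙₐ[ℓ] Omega0 ℓ where
  toFun p := ⟨(p : Polynomial ℓ).comp (1 - X), by
    obtain ⟨q, hq⟩ := p.2
    exact ⟨q.comp (1 - X), by rw [hq]; simp; ring⟩⟩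
  map_add' p q := by ext : 1; simp
  map_mul' p q := by ext : 1; simp
  map_zero' := by ext : 1; simp
  map_smul' c p := by ext : 1; simp

/-- The involution of `Ω₁` reversing paths, `(p(t), q(t)) ↦ (q(1 - t), p(1 - t))`. -/
noncomputable def Omega1.reverse : Omega1 ℓ →ₙₐ[ℓ] Omega1 ℓ where
  toFun x := ⟨((x : Polynomial ℓ × Polynomial ℓ).2.comp (1 - X),
      (x : Polynomial ℓ × Polynomial ℓ).1.comp (1 - X)), by
    obtain ⟨h1, h2, h3⟩ := x.2
    exact ⟨by simp [h1], by simp [h3], by simp [h2]⟩⟩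
  map_add' p q := by ext : 1; simp
  map_mul' p q := by ext : 1; simp
  map_zero' := by ext : 1; simp
  map_smul' c p := by ext : 1; simp

theorem Omega1.reverse_comp_betaTildeMap_comp_reverse :
    (Omega1.reverse ℓ).comp ((betaTildeMap ℓ).comp (Omega0.reverse ℓ)) = betaMap ℓ := by
  ext p : 2
  have h : ((p : Polynomial ℓ).comp (1 - X)).comp (1 - X) = p := by
    simp [Polynomial.comp_assoc]
  exact Prod.ext h Polynomial.zero_comp

theorem betaMap_mul_betaTildeMap (p q : Omega0 ℓ) : betaMap ℓ p * betaTildeMap ℓ q = 0 := by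
  ext : 1
  exact Prod.ext (mul_zero _) (zero_mul _)

/-- Over a domain, a homomorphism `Ω₁ → Ω₀` vanishes on one of the two copies of `Ω₀`. -/
theorem comp_betaMap_eq_zero_or_comp_betaTildeMap_eq_zero [IsDomain ℓ]
    (g : Omega1 ℓ →ₙₐ[ℓ] Omega0 ℓ) :
    g.comp (betaMap ℓ) = 0 ∨ g.comp (betaTildeMap ℓ) = 0 := by
  by_contra! h
  obtain ⟨p, hp⟩ := DFunLike.ne_iff.mp h.1
  obtain ⟨q, hq⟩ := DFunLike.ne_iff.mp h.2
  have hpq : g (betaMap ℓ p) * g (betaTildeMap ℓ q) = 0 := by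
    rw [← map_mul, betaMap_mul_betaTildeMap, map_zero]
  rcases mul_eq_zero.mp (congrArg Subtype.val hpq) with h0 | h0
  · exact hp (Subtype.ext h0)
  · exact hq (Subtype.ext h0)

/-- Let `ℓ` be an integral domain.  If `β : Ω₀ → Ω₁`, `β(p) = (p,0)`, is a
polynomial homotopy equivalence, then the `ℓ`-algebra `Ω₀` is polynomially contractible, i.e.
the identity of `Ω₀` is polynomially homotopic to the zero endomorphism. -/
theorem stmt2 [IsDomain ℓ] (h : IsPHE ℓ (betaMap ℓ)) :
    Homotopic (NonUnitalAlgHom.id ℓ (Omega0 ℓ)) 0 := by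
  obtain ⟨g, hgβ, hβg⟩ := h
  refine .trans _ _ _ (.symm _ _ hgβ) ?_
  rcases comp_betaMap_eq_zero_or_comp_betaTildeMap_eq_zero ℓ g with h0 | h0
  · rw [h0]
    exact .refl _
  · have key := ((hβg.comp_right (betaTildeMap ℓ)).comp_right (Omega0.reverse ℓ)).comp_left
      (g.comp (Omega1.reverse ℓ))
    have hl : (g.comp (Omega1.reverse ℓ)).comp
        ((((betaMap ℓ).comp g).comp (betaTildeMap ℓ)).comp (Omega0.reverse ℓ)) = 0 := by
      ext x : 1
      have hx : g (betaTildeMap ℓ (Omega0.reverse ℓ x)) = 0 := DFunLike.congr_fun h0 _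
      simp [hx]
    have hr : (g.comp (Omega1.reverse ℓ)).comp
        (((NonUnitalAlgHom.id ℓ (Omega1 ℓ)).comp (betaTildeMap ℓ)).comp (Omega0.reverse ℓ))
        = g.comp (betaMap ℓ) := by
      rw [← Omega1.reverse_comp_betaTildeMap_comp_reverse]
      rfl
    rw [hl, hr] at key
    exact .symm _ _ key
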